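/- arXiv:1203.2893 — 5 statements merged into one kernel-verified Lean document; each statement's English description precedes it below -/
import Mathlib

section
/- For every ε > 0 and every real a ≠ 0, the integral identity 2ε · ∫_ℝ cos(2πas)/cosh(2π√ε·s)² ds = a / sinh(πa/(2√ε)) holds (in particular the integral converges). -/
open Real MeasureTheory

lemma sigmoid_mul_one_sub_sigmoid (x : ℝ) :
    sigmoid x * (1 - sigmoid x) = 1 / (4 * Real.cosh (x / 2) ^ 2) := by
  have h : 4 * Real.cosh (x / 2) ^ 2 = (1 + Real.exp (-x)) * (1 + Real.exp x) := by
    have h1 : Real.exp x = Real.exp (x / 2) ^ 2 := by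
      rw [← Real.exp_nat_mul]; congr 1; push_cast; ring
    have h2 : Real.exp (-x) = Real.exp (-(x / 2)) ^ 2 := by
      rw [← Real.exp_nat_mul]; congr 1; push_cast; ring
    have h3 : Real.exp (x / 2) * Real.exp (-(x / 2)) = 1 := by rw [← Real.exp_add]; simp
    rw [Real.cosh_eq, h1, h2]
    linear_combination (1 - Real.exp (x / 2) * Real.exp (-(x / 2))) * h3
  rw [h, ← sigmoid_neg, sigmoid_def, sigmoid_def, neg_neg, one_div, mul_inv]

lemma log_sigmoid_sub_log_one_sub_sigmoid (x : ℝ) :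
    Real.log (sigmoid x) - Real.log (1 - sigmoid x) = x := by
  have h := sigmoid_mul_rexp_neg x
  rw [← sigmoid_neg, ← h, Real.log_mul (sigmoid_pos x).ne' (Real.exp_pos _).ne', Real.log_exp]
  ring

lemma sigmoid_cpow_mul_one_sub_sigmoid_cpow_neg (x : ℝ) (z : ℂ) :
    (sigmoid x : ℂ) ^ z * (1 - (sigmoid x : ℂ)) ^ (-z) = Complex.exp (z * x) := by
  have h1 : (sigmoid x : ℂ) ≠ 0 := by exact_mod_cast (sigmoid_pos x).ne'
  have hpos : 0 < 1 - sigmoid x := sub_pos.mpr (sigmoid_lt_one x)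
  have h2 : (1 - (sigmoid x : ℂ)) ≠ 0 := by exact_mod_cast hpos.ne'
  have h3 : (1 - (sigmoid x : ℂ)) = ((1 - sigmoid x : ℝ) : ℂ) := by push_cast; rfl
  rw [Complex.cpow_def_of_ne_zero h1, Complex.cpow_def_of_ne_zero h2, ← Complex.exp_add, h3,
    ← Complex.ofReal_log (sigmoid_pos x).le, ← Complex.ofReal_log hpos.le]
  conv_rhs => rw [← log_sigmoid_sub_log_one_sub_sigmoid x]
  push_cast
  ring_nf

lemma betaIntegral_one_add_one_sub {z : ℂ} (hz : z ≠ 0) (h1 : -1 < z.re) (h2 : z.re < 1) :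
    Complex.betaIntegral (1 + z) (1 - z) = π * z / Complex.sin (π * z) := by
  have h := Complex.Gamma_mul_Gamma_eq_betaIntegral (s := 1 + z) (t := 1 - z)
    (by simp; linarith) (by simp; linarith)
  have h3 : (1 + z) + (1 - z) = 1 + 1 := by ring
  rw [h3, Complex.Gamma_add_one 1 one_ne_zero, Complex.Gamma_one, add_comm 1 z,
    Complex.Gamma_add_one z hz, mul_assoc, Complex.Gamma_mul_Gamma_one_sub] at h
  rw [one_mul, one_mul] at h
  rw [add_comm 1 z, ← h]
  ring

lemma sigmoid_beta_integrand (z : ℂ) (x : ℝ) :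
    |sigmoid x * (1 - sigmoid x)| •
      ((sigmoid x : ℂ) ^ (1 + z - 1) * (1 - (sigmoid x : ℂ)) ^ (1 - z - 1)) =
      Complex.exp (z * x) / (4 * Real.cosh (x / 2) ^ 2 : ℝ) := by
  have e1 : 1 + z - 1 = z := by ring
  have e2 : 1 - z - 1 = -z := by ring
  rw [e1, e2, sigmoid_cpow_mul_one_sub_sigmoid_cpow_neg, sigmoid_mul_one_sub_sigmoid,
    abs_of_nonneg (by positivity), Complex.real_smul]
  push_cast
  ring

lemma integrable_cexp_div_cosh_sq {z : ℂ} (h1 : -1 < z.re) (h2 : z.re < 1) :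
    Integrable (fun x : ℝ => Complex.exp (z * x) / (4 * Real.cosh (x / 2) ^ 2 : ℝ)) := by
  have h := Complex.betaIntegral_convergent (u := 1 + z) (v := 1 - z)
    (by simp; linarith) (by simp; linarith)
  rw [intervalIntegrable_iff_integrableOn_Ioo_of_le zero_le_one, ← range_sigmoid,
    ← Set.image_univ, integrableOn_image_iff_integrableOn_abs_deriv_smul MeasurableSet.univ
    (fun x _ => (hasDerivAt_sigmoid x).hasDerivWithinAt) sigmoid_injective.injOn,
    integrableOn_univ] at h
  simpa only [sigmoid_beta_integrand] using h

lemma integral_cexp_div_cosh_sq {z : ℂ} (hz : z ≠ 0) (h1 : -1 < z.re) (h2 : z.re < 1) :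
    ∫ x : ℝ, Complex.exp (z * x) / (4 * Real.cosh (x / 2) ^ 2 : ℝ) =
      π * z / Complex.sin (π * z) := by
  rw [← betaIntegral_one_add_one_sub hz h1 h2, Complex.betaIntegral,
    intervalIntegral.integral_of_le zero_le_one, integral_Ioc_eq_integral_Ioo, ← range_sigmoid,
    ← Set.image_univ, integral_image_eq_integral_abs_deriv_smul MeasurableSet.univ
    (fun x _ => (hasDerivAt_sigmoid x).hasDerivWithinAt) sigmoid_injective.injOn,
    setIntegral_univ]
  simp only [sigmoid_beta_integrand]

lemma re_cexp_mul_I_div_cosh_sq (c x : ℝ) :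
    (Complex.exp (c * Complex.I * x) / (4 * Real.cosh (x / 2) ^ 2 : ℝ)).re =
      Real.cos (c * x) / (4 * Real.cosh (x / 2) ^ 2) := by
  rw [Complex.div_ofReal_re,
    show (c : ℂ) * Complex.I * x = ((c * x : ℝ) : ℂ) * Complex.I by push_cast; ring,
    Complex.exp_ofReal_mul_I_re]

lemma integrable_cos_div_cosh_sq (c : ℝ) :
    Integrable (fun x : ℝ => Real.cos (c * x) / (4 * Real.cosh (x / 2) ^ 2)) := by
  have h := (integrable_cexp_div_cosh_sq (z := c * Complex.I) (by simp) (by simp)).re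
  exact h.congr (.of_forall fun x => re_cexp_mul_I_div_cosh_sq c x)

lemma integral_cos_div_cosh_sq {c : ℝ} (hc : c ≠ 0) :
    ∫ x : ℝ, Real.cos (c * x) / (4 * Real.cosh (x / 2) ^ 2) = π * c / Real.sinh (π * c) := by
  have h := integral_cexp_div_cosh_sq (z := c * Complex.I) (by simp [hc]) (by simp) (by simp)
  have hre := integral_re
    (integrable_cexp_div_cosh_sq (z := c * Complex.I) (by simp) (by simp))
  rw [h] at hre
  simp only [RCLike.re_eq_complex_re, re_cexp_mul_I_div_cosh_sq] at hre
  rw [hre, ← mul_assoc, Complex.sin_mul_I, mul_div_mul_right _ _ Complex.I_ne_zero]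
  norm_cast

/-- For every `ε > 0` and `a ≠ 0`,
`2ε·∫_ℝ cos(2πas)/cosh(2π√ε·s)² ds = a/sinh(πa/(2√ε))`
(in particular the integral converges). -/
theorem stmt_6 (ε a : ℝ) (hε : 0 < ε) (ha : a ≠ 0) :
    Integrable (fun s : ℝ =>
      2 * ε * Real.cos (2 * π * a * s) / Real.cosh (2 * π * Real.sqrt ε * s) ^ 2) ∧
    ∫ s : ℝ, 2 * ε * Real.cos (2 * π * a * s) / Real.cosh (2 * π * Real.sqrt ε * s) ^ 2
      = a / Real.sinh (π * a / (2 * Real.sqrt ε)) := by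
  have hr : 0 < Real.sqrt ε := Real.sqrt_pos.mpr hε
  have hsq : Real.sqrt ε ^ 2 = ε := Real.sq_sqrt hε.le
  have hk : 0 < 4 * π * Real.sqrt ε := by positivity
  have hc : a / (2 * Real.sqrt ε) ≠ 0 := by positivity
  have key : (fun s : ℝ =>
      2 * ε * Real.cos (2 * π * a * s) / Real.cosh (2 * π * Real.sqrt ε * s) ^ 2) =
      fun s : ℝ => 8 * ε * (Real.cos (a / (2 * Real.sqrt ε) * (4 * π * Real.sqrt ε * s)) /
        (4 * Real.cosh (4 * π * Real.sqrt ε * s / 2) ^ 2)) := by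
    funext s
    have e1 : a / (2 * Real.sqrt ε) * (4 * π * Real.sqrt ε * s) = 2 * π * a * s := by
      field_simp; ring
    have e2 : 4 * π * Real.sqrt ε * s / 2 = 2 * π * Real.sqrt ε * s := by ring
    rw [e1, e2]
    ring
  rw [key]
  refine ⟨((integrable_cos_div_cosh_sq _).comp_mul_left' hk.ne').const_mul _, ?_⟩
  rw [integral_const_mul, Measure.integral_comp_mul_left
    (fun x => Real.cos (a / (2 * Real.sqrt ε) * x) / (4 * Real.cosh (x / 2) ^ 2)),
    integral_cos_div_cosh_sq hc, abs_of_pos (inv_pos.mpr hk), smul_eq_mul, ← mul_div_assoc π]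
  have hs : Real.sinh (π * a / (2 * Real.sqrt ε)) ≠ 0 := by
    rw [Ne, Real.sinh_eq_zero]; positivity
  generalize Real.sinh (π * a / (2 * Real.sqrt ε)) = S at hs ⊢
  field_simp
  linear_combination (-8 : ℝ) * hsq
end

section
/- Let ε > 0, a ∈ ℝ with a ≠ 0, and t, θ ∈ ℝ. Define Q(s) = (2/π)·arctan(e^{2π√ε(s−t)}). Then ε · ∫_ℝ (1 − cos(2πQ(s)))·(cos(2π(θ + a(s−t))) + cos(2πs)) ds = (a/sinh(πa/(2√ε)))·cos(2πθ) + (1/sinh(π/(2√ε)))·cos(2πt). -/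
open Real MeasureTheory

/-- The integrand `x ^ z * (1 - x) ^ (-z)` of the Beta integral at `x = sigmoid v`. -/
lemma cpow_sigmoid_mul_cpow_one_sub_sigmoid (z : ℂ) (v : ℝ) :
    (Real.sigmoid v : ℂ) ^ z * (1 - (Real.sigmoid v : ℂ)) ^ (-z) = Complex.exp (z * v) := by
  have hpos := Real.sigmoid_pos v
  have hpos' := Real.sigmoid_pos (-v)
  have hcast : (1 - (Real.sigmoid v : ℂ)) = (Real.sigmoid (-v) : ℂ) := by
    rw [Real.sigmoid_neg]; push_cast; ring
  have hlog : Real.log (Real.sigmoid (-v)) = Real.log (Real.sigmoid v) - v := by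
    rw [← Real.sigmoid_mul_rexp_neg, Real.log_mul hpos.ne' (Real.exp_ne_zero _), Real.log_exp]
    ring
  rw [hcast, Complex.cpow_def_of_ne_zero (by exact_mod_cast hpos.ne'),
    Complex.cpow_def_of_ne_zero (by exact_mod_cast hpos'.ne'), ← Complex.ofReal_log hpos.le,
    ← Complex.ofReal_log hpos'.le, ← Complex.exp_add, hlog]
  push_cast
  congr 1
  ring

lemma abs_deriv_sigmoid (v : ℝ) :
    |Real.sigmoid v * (1 - Real.sigmoid v)| = Real.sigmoid v * (1 - Real.sigmoid v) :=
  abs_of_nonneg (mul_nonneg (Real.sigmoid_nonneg v) (sub_nonneg.2 (Real.sigmoid_le_one v)))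

lemma integrable_deriv_sigmoid :
    Integrable fun v : ℝ => Real.sigmoid v * (1 - Real.sigmoid v) := by
  have h := integrableOn_image_iff_integrableOn_abs_deriv_smul MeasurableSet.univ
    (fun x _ => (Real.hasDerivAt_sigmoid x).hasDerivWithinAt) Real.sigmoid_injective.injOn
    (fun _ : ℝ => (1 : ℝ))
  simp only [Set.image_univ, Real.range_sigmoid, integrableOn_univ, abs_deriv_sigmoid, smul_eq_mul,
    mul_one] at h
  exact h.1 (by simp)

lemma integral_deriv_sigmoid_mul_exp {z : ℂ} (hz : z ≠ 0) (h1 : -1 < z.re) (h2 : z.re < 1) :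
    ∫ v : ℝ, ((Real.sigmoid v * (1 - Real.sigmoid v) : ℝ) : ℂ) * Complex.exp (z * v)
      = π * z / Complex.sin (π * z) := by
  have h := integral_image_eq_integral_abs_deriv_smul MeasurableSet.univ
    (fun x _ => (Real.hasDerivAt_sigmoid x).hasDerivWithinAt) Real.sigmoid_injective.injOn
    (fun x : ℝ => (x : ℂ) ^ z * (1 - (x : ℂ)) ^ (-z))
  simp only [Set.image_univ, Real.range_sigmoid, Measure.restrict_univ, abs_deriv_sigmoid,
    cpow_sigmoid_mul_cpow_one_sub_sigmoid, Complex.real_smul] at h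
  have hB := Complex.Gamma_mul_Gamma_eq_betaIntegral (s := 1 + z) (t := 1 - z)
    (by simpa using by linarith) (by simpa using h2)
  have h11 : (1 + z + (1 - z) : ℂ) = 1 + 1 := by ring
  rw [h11, Complex.Gamma_add_one 1 one_ne_zero, Complex.Gamma_one, add_comm 1 z,
    Complex.Gamma_add_one z hz, mul_assoc, Complex.Gamma_mul_Gamma_one_sub, one_mul, one_mul,
    Complex.betaIntegral, intervalIntegral.integral_of_le zero_le_one,
    integral_Ioc_eq_integral_Ioo] at hB
  rw [← h, mul_div_right_comm, mul_comm _ z, hB]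
  simp

lemma integrable_deriv_sigmoid_mul_cos (c ω : ℝ) :
    Integrable fun v : ℝ => Real.sigmoid v * (1 - Real.sigmoid v) * Real.cos (c + ω * v) :=
  integrable_deriv_sigmoid.mul_bdd (c := 1) (Continuous.aestronglyMeasurable (by fun_prop))
    (Filter.Eventually.of_forall fun v => Real.abs_cos_le_one _)

lemma integral_deriv_sigmoid_mul_cos (c : ℝ) {ω : ℝ} (hω : ω ≠ 0) :
    ∫ v : ℝ, Real.sigmoid v * (1 - Real.sigmoid v) * Real.cos (c + ω * v)
      = π * ω / Real.sinh (π * ω) * Real.cos c := by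
  have hI : (ω * Complex.I : ℂ) ≠ 0 := by simp [hω]
  have h := integral_deriv_sigmoid_mul_exp hI (by simp) (by simp)
  have hint : Integrable fun v : ℝ => Complex.exp (c * Complex.I) *
      (((Real.sigmoid v * (1 - Real.sigmoid v) : ℝ) : ℂ) *
        Complex.exp (ω * Complex.I * v)) := by
    refine (integrable_deriv_sigmoid.ofReal.mul_bdd (c := 1) (Continuous.aestronglyMeasurable (by fun_prop))
      (Filter.Eventually.of_forall fun v => ?_)).const_mul _
    simp [Complex.norm_exp]
  have hre := integral_re hint
  rw [integral_const_mul, h, ← mul_assoc (π : ℂ), Complex.sin_mul_I,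
    mul_div_mul_right _ _ Complex.I_ne_zero] at hre
  have hR : (π * ω / Complex.sinh (π * ω) : ℂ) = ((π * ω / Real.sinh (π * ω) : ℝ) : ℂ) := by
    push_cast; rfl
  rw [hR] at hre
  have hL : ∀ v : ℝ, RCLike.re (Complex.exp (c * Complex.I) *
      (((Real.sigmoid v * (1 - Real.sigmoid v) : ℝ) : ℂ) * Complex.exp (ω * Complex.I * v)))
      = Real.sigmoid v * (1 - Real.sigmoid v) * Real.cos (c + ω * v) := by
    intro v
    rw [mul_left_comm, ← Complex.exp_add,
      show (c * Complex.I + ω * Complex.I * v : ℂ) = ((c + ω * v : ℝ) : ℂ) * Complex.I by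
        push_cast; ring]
    simp only [RCLike.re_to_complex, Complex.re_ofReal_mul, Complex.exp_ofReal_mul_I_re]
  simp only [hL] at hre
  rw [hre, mul_comm (Complex.exp _)]
  simp only [RCLike.re_to_complex, Complex.re_ofReal_mul, Complex.exp_ofReal_mul_I_re]

lemma integrable_deriv_sigmoid_mul_left_mul_cos {k : ℝ} (hk : 0 < k) (b c : ℝ) :
    Integrable fun x : ℝ =>
      Real.sigmoid (k * x) * (1 - Real.sigmoid (k * x)) * Real.cos (c + b * x) := by
  have h := (integrable_deriv_sigmoid_mul_cos c (b / k)).comp_mul_left' hk.ne'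
  refine h.congr (Filter.Eventually.of_forall fun x => ?_)
  have : b / k * (k * x) = b * x := by field_simp
  simp only [this]

lemma integral_deriv_sigmoid_mul_left_mul_cos {k b : ℝ} (hk : 0 < k) (hb : b ≠ 0) (c : ℝ) :
    ∫ x : ℝ, Real.sigmoid (k * x) * (1 - Real.sigmoid (k * x)) * Real.cos (c + b * x)
      = π * b / k ^ 2 / Real.sinh (π * b / k) * Real.cos c := by
  have h := Measure.integral_comp_mul_left
    (fun v => Real.sigmoid v * (1 - Real.sigmoid v) * Real.cos (c + b / k * v)) k
  have hx : ∀ x, b / k * (k * x) = b * x := fun x => by field_simp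
  simp only [hx] at h
  rw [h, integral_deriv_sigmoid_mul_cos c (div_ne_zero hb hk.ne'), abs_of_pos (inv_pos.2 hk),
    smul_eq_mul, ← mul_div_assoc π b k]
  field_simp

/-- The potential along the pendulum homoclinic orbit in terms of the derivative of the sigmoid. -/
lemma one_sub_cos_four_mul_arctan_exp (u : ℝ) :
    1 - Real.cos (4 * Real.arctan (Real.exp u))
      = 8 * (Real.sigmoid (2 * u) * (1 - Real.sigmoid (2 * u))) := by
  have hE : Real.exp (-(2 * u)) = (Real.exp u ^ 2)⁻¹ := by
    rw [Real.exp_neg, ← Real.exp_nat_mul]; norm_num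
  have hpos := Real.exp_pos u
  rw [show 4 * Real.arctan (Real.exp u) = 2 * (2 * Real.arctan (Real.exp u)) by ring,
    Real.cos_two_mul, Real.cos_two_mul, Real.cos_sq_arctan, Real.sigmoid_def, hE]
  field_simp
  ring

/-- Explicit residue evaluation of the Poincaré–Melnikov integral of
Arnold's example at `q = 1/2`: with `Q(s) = (2/π)·arctan(e^{2π√ε(s−t)})`,
`ε·∫_ℝ (1 − cos(2πQ(s)))·(cos(2π(θ + a(s−t))) + cos(2πs)) ds
  = (a/sinh(πa/(2√ε)))·cos(2πθ) + (1/sinh(π/(2√ε)))·cos(2πt)`. -/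
theorem stmt_7 (ε a t θ : ℝ) (hε : 0 < ε) (ha : a ≠ 0)
    (Q : ℝ → ℝ)
    (hQ : ∀ s, Q s = (2 / π) * Real.arctan (Real.exp (2 * π * Real.sqrt ε * (s - t)))) :
    Integrable (fun s : ℝ => (1 - Real.cos (2 * π * Q s)) *
        (Real.cos (2 * π * (θ + a * (s - t))) + Real.cos (2 * π * s))) ∧
    ε * ∫ s : ℝ, (1 - Real.cos (2 * π * Q s)) *
        (Real.cos (2 * π * (θ + a * (s - t))) + Real.cos (2 * π * s))
      = a / Real.sinh (π * a / (2 * Real.sqrt ε)) * Real.cos (2 * π * θ)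
        + 1 / Real.sinh (π / (2 * Real.sqrt ε)) * Real.cos (2 * π * t) := by
  have hs : 0 < √ε := Real.sqrt_pos.2 hε
  have hsq : √ε ^ 2 = ε := Real.sq_sqrt hε.le
  have hk : 0 < 4 * π * √ε := by positivity
  have hk2 : (4 * π * √ε) ^ 2 = 16 * π ^ 2 * ε := by rw [mul_pow, hsq]; ring
  have hker : ∀ s, 1 - Real.cos (2 * π * Q s) = 8 * (Real.sigmoid (4 * π * √ε * (s - t)) *
      (1 - Real.sigmoid (4 * π * √ε * (s - t)))) := by
    intro s
    rw [hQ, show 2 * π * (2 / π * Real.arctan (Real.exp (2 * π * √ε * (s - t))))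
      = 4 * Real.arctan (Real.exp (2 * π * √ε * (s - t))) by field_simp; ring,
      one_sub_cos_four_mul_arctan_exp]
    ring_nf
  set g : ℝ → ℝ → ℝ → ℝ := fun b c x => Real.sigmoid (4 * π * √ε * x) *
    (1 - Real.sigmoid (4 * π * √ε * x)) * Real.cos (c + b * x) with hg
  have hga : Integrable (g (2 * π * a) (2 * π * θ)) :=
    integrable_deriv_sigmoid_mul_left_mul_cos hk _ _
  have hg1 : Integrable (g (2 * π) (2 * π * t)) :=
    integrable_deriv_sigmoid_mul_left_mul_cos hk _ _
  have hfun : (fun s : ℝ => (1 - Real.cos (2 * π * Q s)) *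
      (Real.cos (2 * π * (θ + a * (s - t))) + Real.cos (2 * π * s)))
      = fun s => (fun x => 8 * (g (2 * π * a) (2 * π * θ) x + g (2 * π) (2 * π * t) x))
        (s - t) := by
    funext s
    simp only [hker, hg]
    rw [show 2 * π * (θ + a * (s - t)) = 2 * π * θ + 2 * π * a * (s - t) by ring,
      show 2 * π * s = 2 * π * t + 2 * π * (s - t) by ring]
    ring
  rw [hfun]
  refine ⟨((hga.add hg1).const_mul 8).comp_sub_right t, ?_⟩
  rw [integral_sub_right_eq_self
      (fun x => 8 * (g (2 * π * a) (2 * π * θ) x + g (2 * π) (2 * π * t) x)) t,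
    integral_const_mul, integral_add hga hg1,
    integral_deriv_sigmoid_mul_left_mul_cos hk (by positivity),
    integral_deriv_sigmoid_mul_left_mul_cos hk (by positivity), hk2,
    show π * (2 * π * a) / (4 * π * √ε) = π * a / (2 * √ε) by field_simp; ring,
    show π * (2 * π) / (4 * π * √ε) = π / (2 * √ε) by field_simp; ring,
    show π * (2 * π * a) / (16 * π ^ 2 * ε) = a / (8 * ε) by field_simp; ring,
    show π * (2 * π) / (16 * π ^ 2 * ε) = 1 / (8 * ε) by field_simp; ring]
  field_simp
end

section
/- Let ε > 0, μ, a ∈ ℝ, let f : ℝ³ → ℝ be continuous and 1-periodic in each variable, and let H(t,θ,q,I,p) = p²/2 + I²/2 + ε(cos(2πq) − 1)(1 + μ f(t,θ,q)). Let S⁺, S⁻ : ℝ × ℝ × [−3/4, 3/4] → ℝ be C¹, 1-periodic in (t,θ), and suppose both satisfy the Hamilton–Jacobi equation ∂_t S(t,θ,q) + H(t,θ,q, a + ∂_θ S(t,θ,q), ∂_q S(t,θ,q)) = a²/2 on their domain, with ∂_q S⁺(t,θ,1/2) ≥ 0 and ∂_q S⁻(t,θ,−1/2) ≥ 0 for all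 (t,θ). If (T,Θ) is a critical point of the function (t,θ) ↦ S⁺(t,θ,1/2) − S⁻(t,θ,−1/2), then ∂_t S⁺(T,Θ,1/2) = ∂_t S⁻(T,Θ,−1/2), ∂_θ S⁺(T,Θ,1/2) = ∂_θ S⁻(T,Θ,−1/2), and ∂_q S⁺(T,Θ,1/2) = ∂_q S⁻(T,Θ,−1/2). In particular, (T,Θ,1/2) is a critical point of Δ_a(t,θ,q) := S⁺(t,θ,q) − S⁻(t,θ,q−1), so the graphs {(t,θ,q, a + ∂_θ S^±, ∂_q S^±)} of the two generating functions intersect above (T,Θ,1/2). -/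
open Real

/-- The partial derivatives of a curried function of three real variables are the values of the
Fréchet derivative of its uncurried form on the standard basis. -/
theorem HasFDerivAt.hasDerivAt_partials {S : ℝ → ℝ → ℝ → ℝ} {L : ℝ × ℝ × ℝ →L[ℝ] ℝ} {t θ q : ℝ}
    (h : HasFDerivAt (fun z : ℝ × ℝ × ℝ => S z.1 z.2.1 z.2.2) L (t, θ, q)) :
    HasDerivAt (fun t' => S t' θ q) (L (1, 0, 0)) t ∧
    HasDerivAt (fun θ' => S t θ' q) (L (0, 1, 0)) θ ∧
    HasDerivAt (fun q' => S t θ q') (L (0, 0, 1)) q := by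
  refine ⟨?_, ?_, ?_⟩
  · exact HasFDerivAt.comp_hasDerivAt (f := fun t' => (t', θ, q)) t h
      ((hasDerivAt_id t).prodMk ((hasDerivAt_const t θ).prodMk (hasDerivAt_const t q)))
  · exact HasFDerivAt.comp_hasDerivAt (f := fun θ' => (t, θ', q)) θ h
      ((hasDerivAt_const θ t).prodMk ((hasDerivAt_id θ).prodMk (hasDerivAt_const θ q)))
  · exact HasFDerivAt.comp_hasDerivAt (f := fun q' => (t, θ, q')) q h
      ((hasDerivAt_const q t).prodMk ((hasDerivAt_const q θ).prodMk (hasDerivAt_id q)))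

/-- A linear form on `ℝ × ℝ × ℝ` is determined by its values on the standard basis. -/
theorem ContinuousLinearMap.ext_real_prod₃ {L M : ℝ × ℝ × ℝ →L[ℝ] ℝ}
    (h₁ : L (1, 0, 0) = M (1, 0, 0)) (h₂ : L (0, 1, 0) = M (0, 1, 0))
    (h₃ : L (0, 0, 1) = M (0, 0, 1)) : L = M := by
  ext <;> simpa

/-- In Arnold's example, if the generating functions `S⁺, S⁻` solve
the Hamilton–Jacobi equation `∂ₜS + H(t,θ,q,a+∂_θS,∂_qS) = a²/2` on
`ℝ × ℝ × [−3/4,3/4]` with the sign conditions `∂_qS⁺(·,·,1/2) ≥ 0` and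
`∂_qS⁻(·,·,−1/2) ≥ 0`, then at any critical point `(T,Θ)` of
`(t,θ) ↦ S⁺(t,θ,1/2) − S⁻(t,θ,−1/2)` all three partial derivatives of `S⁺` at
`(T,Θ,1/2)` and of `S⁻` at `(T,Θ,−1/2)` agree; in particular `(T,Θ,1/2)` is a
critical point of `Δ_a(t,θ,q) = S⁺(t,θ,q) − S⁻(t,θ,q−1)`, so the graphs of the
two generating functions intersect above `(T,Θ,1/2)`. -/
theorem stmt_9 (ε μ a : ℝ) (hε : 0 < ε)
    (f : ℝ → ℝ → ℝ → ℝ)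
    (hfc : Continuous fun z : ℝ × ℝ × ℝ => f z.1 z.2.1 z.2.2)
    (hfper : ∀ t θ q, f (t + 1) θ q = f t θ q ∧ f t (θ + 1) q = f t θ q ∧
      f t θ (q + 1) = f t θ q)
    (H : ℝ → ℝ → ℝ → ℝ → ℝ → ℝ)
    (hH : ∀ t θ q I p, H t θ q I p =
      p ^ 2 / 2 + I ^ 2 / 2 + ε * (Real.cos (2 * π * q) - 1) * (1 + μ * f t θ q))
    (Sp Sm : ℝ → ℝ → ℝ → ℝ)
    (hSp : ContDiff ℝ 1 fun z : ℝ × ℝ × ℝ => Sp z.1 z.2.1 z.2.2)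
    (hSm : ContDiff ℝ 1 fun z : ℝ × ℝ × ℝ => Sm z.1 z.2.1 z.2.2)
    (hSpper : ∀ t θ q, Sp (t + 1) θ q = Sp t θ q ∧ Sp t (θ + 1) q = Sp t θ q)
    (hSmper : ∀ t θ q, Sm (t + 1) θ q = Sm t θ q ∧ Sm t (θ + 1) q = Sm t θ q)
    (hHJp : ∀ t θ : ℝ, ∀ q ∈ Set.Icc (-(3 : ℝ)/4) (3/4),
      deriv (fun t' => Sp t' θ q) t
        + H t θ q (a + deriv (fun θ' => Sp t θ' q) θ) (deriv (fun q' => Sp t θ q') q)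
        = a ^ 2 / 2)
    (hHJm : ∀ t θ : ℝ, ∀ q ∈ Set.Icc (-(3 : ℝ)/4) (3/4),
      deriv (fun t' => Sm t' θ q) t
        + H t θ q (a + deriv (fun θ' => Sm t θ' q) θ) (deriv (fun q' => Sm t θ q') q)
        = a ^ 2 / 2)
    (hsignp : ∀ t θ : ℝ, 0 ≤ deriv (fun q' => Sp t θ q') (1/2))
    (hsignm : ∀ t θ : ℝ, 0 ≤ deriv (fun q' => Sm t θ q') (-(1 : ℝ)/2))
    (T Θ : ℝ)
    (hcrit : fderiv ℝ
      (fun z : ℝ × ℝ => Sp z.1 z.2 (1/2) - Sm z.1 z.2 (-(1 : ℝ)/2)) (T, Θ) = 0) :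
    deriv (fun t' => Sp t' Θ (1/2)) T = deriv (fun t' => Sm t' Θ (-(1 : ℝ)/2)) T ∧
    deriv (fun θ' => Sp T θ' (1/2)) Θ = deriv (fun θ' => Sm T θ' (-(1 : ℝ)/2)) Θ ∧
    deriv (fun q' => Sp T Θ q') (1/2) = deriv (fun q' => Sm T Θ q') (-(1 : ℝ)/2) ∧
    fderiv ℝ
      (fun z : ℝ × ℝ × ℝ => Sp z.1 z.2.1 z.2.2 - Sm z.1 z.2.1 (z.2.2 - 1))
      (T, Θ, 1/2) = 0 := by
  have hp := (hSp.differentiable one_ne_zero (T, Θ, 1/2)).hasFDerivAt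
  have hm := (hSm.differentiable one_ne_zero (T, Θ, -(1 : ℝ)/2)).hasFDerivAt
  obtain ⟨hpt, hpθ, hpq⟩ := hp.hasDerivAt_partials
  obtain ⟨hmt, hmθ, hmq⟩ := hm.hasDerivAt_partials
  have hd : HasFDerivAt (𝕜 := ℝ)
      (fun z : ℝ × ℝ => Sp z.1 z.2 (1/2) - Sm z.1 z.2 (-(1 : ℝ)/2)) 0 (T, Θ) := by
    rw [← hcrit]
    have hi (c : ℝ) : Differentiable ℝ fun z : ℝ × ℝ => (z.1, z.2, c) := by fun_prop
    have hdiff : Differentiable ℝ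
        fun z : ℝ × ℝ => Sp z.1 z.2 (1/2) - Sm z.1 z.2 (-(1 : ℝ)/2) :=
      ((hSp.differentiable one_ne_zero).comp (hi (1/2))).sub
        ((hSm.differentiable one_ne_zero).comp (hi (-(1 : ℝ)/2)))
    exact (hdiff (T, Θ)).hasFDerivAt
  have ht : deriv (fun t' => Sp t' Θ (1/2)) T = deriv (fun t' => Sm t' Θ (-(1 : ℝ)/2)) T := by
    have h := HasFDerivAt.comp_hasDerivAt (f := fun t' => (t', Θ)) T hd
      ((hasDerivAt_id T).prodMk (hasDerivAt_const T Θ))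
    have := h.unique (hpt.sub hmt)
    rw [hpt.deriv, hmt.deriv]
    exact sub_eq_zero.mp this.symm
  have hθ : deriv (fun θ' => Sp T θ' (1/2)) Θ = deriv (fun θ' => Sm T θ' (-(1 : ℝ)/2)) Θ := by
    have h := HasFDerivAt.comp_hasDerivAt (f := fun θ' => (T, θ')) Θ hd
      ((hasDerivAt_const Θ T).prodMk (hasDerivAt_id Θ))
    have := h.unique (hpθ.sub hmθ)
    rw [hpθ.deriv, hmθ.deriv]
    exact sub_eq_zero.mp this.symm
  have hq : deriv (fun q' => Sp T Θ q') (1/2) = deriv (fun q' => Sm T Θ q') (-(1 : ℝ)/2) := by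
    have ep := hHJp T Θ (1/2) ⟨by norm_num, by norm_num⟩
    have em := hHJm T Θ (-(1 : ℝ)/2) ⟨by norm_num, by norm_num⟩
    have hf : f T Θ (1/2) = f T Θ (-(1 : ℝ)/2) := by
      rw [← (hfper T Θ (-(1 : ℝ)/2)).2.2]
      norm_num
    have hcos : Real.cos (2 * π * (1/2)) = Real.cos (2 * π * (-(1 : ℝ)/2)) := by
      rw [← Real.cos_neg]
      ring_nf
    rw [hH, ht, hθ, hf, hcos] at ep
    rw [hH] at em
    exact (sq_eq_sq₀ (hsignp T Θ) (hsignm T Θ)).mp (by linarith)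
  refine ⟨ht, hθ, hq, ?_⟩
  have hLM := ContinuousLinearMap.ext_real_prod₃
    (hpt.deriv.symm.trans (ht.trans hmt.deriv)) (hpθ.deriv.symm.trans (hθ.trans hmθ.deriv))
    (hpq.deriv.symm.trans (hq.trans hmq.deriv))
  have hshift : HasFDerivAt (fun z : ℝ × ℝ × ℝ => (z.1, z.2.1, z.2.2 - 1))
      (ContinuousLinearMap.id ℝ (ℝ × ℝ × ℝ)) (T, Θ, 1/2) := by
    have he : (fun z : ℝ × ℝ × ℝ => (z.1, z.2.1, z.2.2 - 1)) = fun z => z - (0, 0, 1) := by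
      ext z <;> simp
    rw [he]
    exact (hasFDerivAt_id _).sub_const _
  rw [show (T, Θ, -(1 : ℝ)/2) = (T, Θ, (1/2 : ℝ) - 1) by norm_num] at hm hLM
  have h := hp.sub (HasFDerivAt.comp (f := fun z : ℝ × ℝ × ℝ => (z.1, z.2.1, z.2.2 - 1))
    (T, Θ, 1/2) hm hshift)
  rw [ContinuousLinearMap.comp_id, hLM, sub_self] at h
  exact h.fderiv
end

section
/- Let A ⊂ ℝ be open and let P, N : A × ℝ × ℝ → ℝ be C², with P(a,·,·) and N(a,·,·) 1-periodic in both of their last two variables for every a ∈ A; define Σ_{a,a'}(t,θ) = P(a,t,θ) − N(a',t,θ) + (a − a')θ. Let [a⁻, a⁺] ⊂ A be a compact interval such that for every a ∈ [a⁻, a⁺] the function Σ_{a,a} has a nondegenerate critical point. Then there exist k ∈ ℕ and a finite sequence a⁻ = a₀, a₁, …, a_k = a⁺ of points of [a⁻, a⁺] such that for each i ∈ {1,…,k} the function Σ_{a_{i−1}, a_i} has a nondegenerate critical point (an elementary transition chain from a⁻ to a⁺). -/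
open Real

/-- Second partial derivative of `g : ℝ² → ℝ` at `z` in the directions `v`, `w`. -/
noncomputable def secondPartial (g : ℝ × ℝ → ℝ) (z v w : ℝ × ℝ) : ℝ :=
  deriv (fun s : ℝ => fderiv ℝ g (z + s • v) w) 0

/-- A nondegenerate critical point of `g : ℝ² → ℝ`: the gradient of `g`
vanishes there and the Hessian matrix of `g` there is invertible
(nonzero determinant). -/
noncomputable def IsNondegCritPt (g : ℝ × ℝ → ℝ) (z : ℝ × ℝ) : Prop :=
  fderiv ℝ g z = 0 ∧
  secondPartial g z (1, 0) (1, 0) * secondPartial g z (0, 1) (0, 1)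
    - secondPartial g z (1, 0) (0, 1) * secondPartial g z (0, 1) (1, 0) ≠ 0

open Filter Topology

section Parametric

variable {E : Type*} [NormedAddCommGroup E] [NormedSpace ℝ E]

/-- The partial derivative of `F` at `p` in the direction `w` of the plane, for a family `F` of
functions on the plane parametrized by `E`. -/
noncomputable def planePartial (F : E × (ℝ × ℝ) → ℝ) (w : ℝ × ℝ) (p : E × (ℝ × ℝ)) : ℝ :=
  fderiv ℝ F p (0, w)

theorem fderiv_slice_apply {F : E × (ℝ × ℝ) → ℝ} {p : E × (ℝ × ℝ)}
    (hF : DifferentiableAt ℝ F p) (w : ℝ × ℝ) :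
    fderiv ℝ (fun z => F (p.1, z)) p.2 w = planePartial F w p := by
  have h1 : HasFDerivAt (fun z : ℝ × ℝ => (p.1, z)) (.inr ℝ E (ℝ × ℝ)) p.2 :=
    hasFDerivAt_prodMk_right p.1 p.2
  have h2 : HasFDerivAt (fun z => F (p.1, z)) (fderiv ℝ F p ∘L .inr ℝ E (ℝ × ℝ)) p.2 :=
    HasFDerivAt.comp p.2 (g := F) hF.hasFDerivAt h1
  rw [h2.fderiv]
  rfl

theorem ContDiffAt.planePartial {F : E × (ℝ × ℝ) → ℝ} {p : E × (ℝ × ℝ)}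
    (hF : ContDiffAt ℝ 2 F p) (w : ℝ × ℝ) : ContDiffAt ℝ 1 (planePartial F w) p :=
  (hF.fderiv_right (m := 1) (by norm_num)).clm_apply contDiffAt_const

theorem secondPartial_slice {F : E × (ℝ × ℝ) → ℝ} {p : E × (ℝ × ℝ)}
    (hF : ContDiffAt ℝ 2 F p) (v w : ℝ × ℝ) :
    secondPartial (fun z => F (p.1, z)) p.2 v w = fderiv ℝ (planePartial F w) p (0, v) := by
  have hcurve : HasDerivAt (fun s : ℝ => (p.1, p.2 + s • v)) ((0 : E), v) 0 := by
    have h : HasDerivAt (fun s : ℝ => p.2 + s • v) v 0 := by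
      simpa using ((hasDerivAt_id (0 : ℝ)).smul_const v).const_add p.2
    exact (hasDerivAt_const (0 : ℝ) p.1).prodMk h
  have hbase : (fun s : ℝ => (p.1, p.2 + s • v)) 0 = p := by simp
  have htend : Tendsto (fun s : ℝ => (p.1, p.2 + s • v)) (𝓝 0) (𝓝 p) := by
    simpa only [hbase] using hcurve.continuousAt.tendsto
  have hdiff : ∀ᶠ q in 𝓝 p, DifferentiableAt ℝ F q :=
    (hF.eventually (by simp)).mono fun q hq => hq.differentiableAt (by norm_num)
  have heq : (fun s : ℝ => fderiv ℝ (fun z => F (p.1, z)) (p.2 + s • v) w)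
      =ᶠ[𝓝 0] fun s => planePartial F w (p.1, p.2 + s • v) :=
    (htend.eventually hdiff).mono fun s hs => fderiv_slice_apply hs w
  have hpp : HasFDerivAt (planePartial F w) (fderiv ℝ (planePartial F w) p)
      ((fun s : ℝ => (p.1, p.2 + s • v)) 0) := by
    rw [hbase]
    exact ((hF.planePartial w).differentiableAt (by norm_num)).hasFDerivAt
  rw [secondPartial, heq.deriv_eq]
  exact (hpp.comp_hasDerivAt (0 : ℝ) hcurve).deriv

theorem ContinuousLinearMap.isInvertible_of_det_ne_zero (T : ℝ × ℝ →L[ℝ] ℝ × ℝ)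
    (hT : (T (1, 0)).1 * (T (0, 1)).2 - (T (1, 0)).2 * (T (0, 1)).1 ≠ 0) : T.IsInvertible := by
  have hinj : Function.Injective (T : ℝ × ℝ →ₗ[ℝ] ℝ × ℝ) := by
    rw [injective_iff_map_eq_zero]
    rintro ⟨x, y⟩ hxy
    have hdecomp : T (x, y) = x • T (1, 0) + y • T (0, 1) := by
      rw [← map_smul, ← map_smul, ← map_add]
      simp
    have h0 : x • T (1, 0) + y • T (0, 1) = 0 := hdecomp ▸ hxy
    have h1 := congrArg Prod.fst h0
    have h2 := congrArg Prod.snd h0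
    simp only [Prod.fst_add, Prod.snd_add, Prod.smul_fst, Prod.smul_snd, smul_eq_mul,
      Prod.fst_zero, Prod.snd_zero] at h1 h2
    have hx : x = 0 := by
      refine (mul_eq_zero.mp ?_).resolve_right hT
      linear_combination (T (0, 1)).2 * h1 - (T (0, 1)).1 * h2
    have hy : y = 0 := by
      refine (mul_eq_zero.mp ?_).resolve_right hT
      linear_combination (T (1, 0)).1 * h2 - (T (1, 0)).2 * h1
    rw [hx, hy]
    rfl
  exact ⟨(LinearEquiv.ofInjectiveEndo (T : ℝ × ℝ →ₗ[ℝ] ℝ × ℝ) hinj).toContinuousLinearEquiv,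
    by ext <;> rfl⟩

/-- Nondegenerate critical points persist under perturbation of the parameter. -/
theorem IsNondegCritPt.eventually_exists [CompleteSpace E] {F : E × (ℝ × ℝ) → ℝ} {e₀ : E}
    {z₀ : ℝ × ℝ} (hF : ContDiffAt ℝ 2 F (e₀, z₀))
    (hz : IsNondegCritPt (fun z => F (e₀, z)) z₀) :
    ∀ᶠ e in 𝓝 e₀, ∃ z, IsNondegCritPt (fun z => F (e, z)) z := by
  have hF' : ∀ᶠ q in 𝓝 (e₀, z₀), ContDiffAt ℝ 2 F q := hF.eventually (by simp)
  set D : E × (ℝ × ℝ) → ℝ × ℝ → ℝ × ℝ → ℝ := fun p v w =>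
    fderiv ℝ (planePartial F w) p (0, v)
  have hDcont : ∀ v w, ContinuousAt (fun p => D p v w) (e₀, z₀) := fun v w =>
    ((hF.planePartial w).continuousAt_fderiv (by norm_num)).clm_apply continuousAt_const
  set det : E × (ℝ × ℝ) → ℝ := fun p =>
    D p (1, 0) (1, 0) * D p (0, 1) (0, 1) - D p (1, 0) (0, 1) * D p (0, 1) (1, 0)
  have hdetcont : ContinuousAt det (e₀, z₀) :=
    ((hDcont _ _).mul (hDcont _ _)).sub ((hDcont _ _).mul (hDcont _ _))
  obtain ⟨hgrad, hhess⟩ := hz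
  have hhess' : det (e₀, z₀) ≠ 0 := by
    simpa only [secondPartial_slice (p := (e₀, z₀)) hF] using hhess
  have hdiff₀ : DifferentiableAt ℝ F (e₀, z₀) := hF.differentiableAt (by norm_num)
  have hpart₀ : ∀ w, planePartial F w (e₀, z₀) = 0 := fun w => by
    rw [← fderiv_slice_apply hdiff₀ w, hgrad]
    rfl
  set G : E × (ℝ × ℝ) → ℝ × ℝ := fun p => (planePartial F (1, 0) p, planePartial F (0, 1) p)
  have hG : ContDiffAt ℝ 1 G (e₀, z₀) := (hF.planePartial _).prodMk (hF.planePartial _)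
  have hGderiv : fderiv ℝ G (e₀, z₀) = (fderiv ℝ (planePartial F (1, 0)) (e₀, z₀)).prod
      (fderiv ℝ (planePartial F (0, 1)) (e₀, z₀)) :=
    ((hF.planePartial _).differentiableAt (by norm_num)).fderiv_prodMk
      ((hF.planePartial _).differentiableAt (by norm_num))
  have hinv : (fderiv ℝ G (e₀, z₀) ∘L .inr ℝ E (ℝ × ℝ)).IsInvertible := by
    apply ContinuousLinearMap.isInvertible_of_det_ne_zero
    rw [hGderiv]
    exact hhess'
  have hstrict := hG.hasStrictFDerivAt (by norm_num)
  set ψ := hstrict.implicitFunctionOfProdDomain hinv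
  have hψ : Tendsto ψ (𝓝 e₀) (𝓝 z₀) := hstrict.tendsto_implicitFunctionOfProdDomain hinv
  have hgraph : Tendsto (fun e => (e, ψ e)) (𝓝 e₀) (𝓝 (e₀, z₀)) := tendsto_id.prodMk_nhds hψ
  filter_upwards [hstrict.eventually_apply_implicitFunctionOfProdDomain hinv,
    hgraph.eventually hF', hgraph.eventually (hdetcont.eventually_ne hhess')] with e he hCe hde
  have he' : G (e, ψ e) = 0 := he.trans (Prod.ext (hpart₀ _) (hpart₀ _))
  have hdiff : DifferentiableAt ℝ F (e, ψ e) := hCe.differentiableAt (by norm_num)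
  refine ⟨ψ e, ?_, ?_⟩
  · have h1 := (fderiv_slice_apply hdiff (1, 0)).trans (congrArg Prod.fst he')
    have h2 := (fderiv_slice_apply hdiff (0, 1)).trans (congrArg Prod.snd he')
    ext
    · simpa using h1
    · simpa using h2
  · simpa only [secondPartial_slice (p := (e, ψ e)) hCe] using hde

end Parametric

/-- A relation containing a neighbourhood of the diagonal of a compact interval links its
endpoints by a finite chain. -/
theorem exists_chain_of_eventually {R : ℝ × ℝ → Prop} {a b : ℝ} (hab : a ≤ b)
    (hR : ∀ x ∈ Set.Icc a b, ∀ᶠ e in 𝓝 (x, x), R e) :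
    ∃ (k : ℕ) (seq : ℕ → ℝ), seq 0 = a ∧ seq k = b ∧ (∀ i ≤ k, seq i ∈ Set.Icc a b) ∧
      ∀ i, 1 ≤ i → i ≤ k → R (seq (i - 1), seq i) := by
  have hcompact : IsCompact ((fun x : ℝ => (x, x)) '' Set.Icc a b) :=
    isCompact_Icc.image (by fun_prop)
  obtain ⟨δ, hδ, hball⟩ := lebesgue_number_lemma_of_metric (ι := Unit) hcompact
    (c := fun _ => interior {e | R e}) (fun _ => isOpen_interior) (by
      rintro _ ⟨x, hx, rfl⟩
      exact Set.mem_iUnion.mpr ⟨(), mem_interior_iff_mem_nhds.mpr (hR x hx)⟩)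
  obtain ⟨k, hk⟩ := exists_nat_ge ((b - a) / (δ / 2))
  rw [div_le_iff₀ (by positivity)] at hk
  have hmem : ∀ i : ℕ, min (a + i * (δ / 2)) b ∈ Set.Icc a b := fun i =>
    ⟨le_min (le_add_of_nonneg_right (by positivity)) hab, min_le_right _ _⟩
  refine ⟨k, fun i => min (a + i * (δ / 2)) b, by simpa using hab,
    min_eq_right (by linarith), fun i _ => hmem i, ?_⟩
  intro i hi _
  obtain ⟨j, rfl⟩ := Nat.exists_eq_add_of_le' hi
  obtain ⟨-, hsub⟩ := hball _ ⟨_, hmem j, rfl⟩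
  refine interior_subset (hsub ?_)
  rw [Metric.mem_ball, Prod.dist_eq]
  refine max_lt ?_ ?_
  · simpa using hδ
  · refine (abs_min_sub_min_le_max _ _ _ _).trans_lt ?_
    push_cast
    have : a + (j + 1) * (δ / 2) - (a + j * (δ / 2)) = δ / 2 := by ring
    rw [this, sub_self, abs_zero, abs_of_pos (by positivity)]
    exact max_lt (by linarith) hδ

/-- With `P(a,·,·)`, `N(a,·,·)` C² in all variables on `A × ℝ²`
and 1-periodic in the last two variables, and
`Σ_{a,a'}(t,θ) = P(a,t,θ) − N(a',t,θ) + (a−a')θ`: if `[a⁻,a⁺] ⊆ A` and for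
every `a ∈ [a⁻,a⁺]` the function `Σ_{a,a}` has a nondegenerate critical point,
then there is a finite sequence `a⁻ = a₀, a₁, …, a_k = a⁺` in `[a⁻,a⁺]` such
that each `Σ_{a_{i−1},a_i}` has a nondegenerate critical point (an elementary
transition chain from `a⁻` to `a⁺`). -/
theorem stmt_11 (A : Set ℝ) (hA : IsOpen A)
    (P N : ℝ → ℝ → ℝ → ℝ)
    (hP : ContDiffOn ℝ 2 (fun z : ℝ × ℝ × ℝ => P z.1 z.2.1 z.2.2)
      (A ×ˢ (Set.univ : Set (ℝ × ℝ))))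
    (hN : ContDiffOn ℝ 2 (fun z : ℝ × ℝ × ℝ => N z.1 z.2.1 z.2.2)
      (A ×ˢ (Set.univ : Set (ℝ × ℝ))))
    (hPper : ∀ a ∈ A, ∀ t θ : ℝ, P a (t + 1) θ = P a t θ ∧ P a t (θ + 1) = P a t θ)
    (hNper : ∀ a ∈ A, ∀ t θ : ℝ, N a (t + 1) θ = N a t θ ∧ N a t (θ + 1) = N a t θ)
    (Sig : ℝ → ℝ → ℝ × ℝ → ℝ)
    (hSig : ∀ a a' : ℝ, ∀ z : ℝ × ℝ,
      Sig a a' z = P a z.1 z.2 - N a' z.1 z.2 + (a - a') * z.2)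
    (aminus aplus : ℝ) (hle : aminus ≤ aplus)
    (hsub : Set.Icc aminus aplus ⊆ A)
    (hcrit : ∀ a ∈ Set.Icc aminus aplus, ∃ z, IsNondegCritPt (Sig a a) z) :
    ∃ (k : ℕ) (seq : ℕ → ℝ), seq 0 = aminus ∧ seq k = aplus ∧
      (∀ i ≤ k, seq i ∈ Set.Icc aminus aplus) ∧
      ∀ i, 1 ≤ i → i ≤ k → ∃ z, IsNondegCritPt (Sig (seq (i - 1)) (seq i)) z := by
  refine exists_chain_of_eventually
    (R := fun e : ℝ × ℝ => ∃ z, IsNondegCritPt (Sig e.1 e.2) z) hle fun a ha => ?_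
  obtain ⟨z, hz⟩ := hcrit a ha
  have hnhds : ∀ w : ℝ × ℝ, A ×ˢ (Set.univ : Set (ℝ × ℝ)) ∈ 𝓝 (a, w) := fun w =>
    (hA.prod isOpen_univ).mem_nhds ⟨hsub ha, Set.mem_univ _⟩
  have hSig' : (fun q : (ℝ × ℝ) × (ℝ × ℝ) => Sig q.1.1 q.1.2 q.2) = fun q =>
      P q.1.1 q.2.1 q.2.2 - N q.1.2 q.2.1 q.2.2 + (q.1.1 - q.1.2) * q.2.2 :=
    funext fun q => hSig _ _ _
  have hPat := (hP.contDiffAt (hnhds z)).comp (f := fun q : (ℝ × ℝ) × (ℝ × ℝ) => (q.1.1, q.2))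
    ((a, a), z) (by fun_prop)
  have hNat := (hN.contDiffAt (hnhds z)).comp (f := fun q : (ℝ × ℝ) × (ℝ × ℝ) => (q.1.2, q.2))
    ((a, a), z) (by fun_prop)
  have hF : ContDiffAt ℝ 2 (fun q : (ℝ × ℝ) × (ℝ × ℝ) => Sig q.1.1 q.1.2 q.2) ((a, a), z) := by
    rw [hSig']
    exact (hPat.sub hNat).add (by fun_prop)
  exact IsNondegCritPt.eventually_exists hF hz
end

section
/- Let Ω ⊂ ℝ³ be open (coordinates (t,θ,q)), let u : Ω → ℝ be continuous, let a, c ∈ ℝ, and let S¹, S² : Ω → ℝ be C² functions both satisfying the same Hamilton–Jacobi equation ∂_t S + ½(a + ∂_θ S)² + ½(∂_q S)² + u(t,θ,q) = c on Ω. Set Δ = S¹ − S². If z₀ ∈ Ω is a critical point of Δ (∇Δ(z₀) = 0), then the Hessian matrix of Δ at z₀ is singular: the nonzero vector (1, a + ∂_θ S¹(z₀), ∂_q S¹(z₀)) lies in its kernel. In particular the Hessian of Δ at a critical point has rank at most 2. -/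
open Real

open scoped Topology

/-- The derivative of the Hamilton–Jacobi expression of a function whose gradient field `P` has
derivative `H` at `z`, in the direction `w`, is `H w` paired with the characteristic direction. -/
lemma hasFDerivAt_hamiltonJacobi {E : Type*} [NormedAddCommGroup E] [NormedSpace ℝ E]
    {P : E → E →L[ℝ] ℝ} {H : E →L[ℝ] E →L[ℝ] ℝ} {z : E} (hP : HasFDerivAt P H z)
    (a : ℝ) (e₁ e₂ e₃ : E) :
    HasFDerivAt (fun x => P x e₁ + (a + P x e₂) ^ 2 / 2 + (P x e₃) ^ 2 / 2)
      (H.flip (e₁ + (a + P z e₂) • e₂ + P z e₃ • e₃)) z := by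
  have key (e : E) : HasFDerivAt (fun x => P x e) (H.flip e) z := by
    simpa using hP.clm_apply (hasFDerivAt_const e z)
  have h₂ := (((key e₂).const_add a).pow 2).mul_const (2⁻¹ : ℝ)
  have h₃ := ((key e₃).pow 2).mul_const (2⁻¹ : ℝ)
  refine (((key e₁).add h₂).add h₃).congr_fderiv ?_
  ext w
  simp
  ring

/-- If `S¹, S²` are C² solutions on open `Ω ⊆ ℝ³` of the same
Hamilton–Jacobi equation `∂ₜS + ½(a + ∂_θS)² + ½(∂_qS)² + u = c` (with `u`
merely continuous), and `z₀ ∈ Ω` is a critical point of `Δ = S¹ − S²`, then the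
Hessian of `Δ` at `z₀` is singular: the nonzero vector
`(1, a + ∂_θS¹(z₀), ∂_qS¹(z₀))` lies in its kernel; in particular the Hessian
has rank at most 2. -/
theorem stmt_19 (Ω : Set (ℝ × ℝ × ℝ)) (hΩ : IsOpen Ω)
    (u : ℝ × ℝ × ℝ → ℝ) (hu : ContinuousOn u Ω)
    (a c : ℝ) (S₁ S₂ : ℝ × ℝ × ℝ → ℝ)
    (hS₁ : ContDiffOn ℝ 2 S₁ Ω) (hS₂ : ContDiffOn ℝ 2 S₂ Ω)
    (hHJ₁ : ∀ z ∈ Ω, fderiv ℝ S₁ z ((1 : ℝ), (0 : ℝ), (0 : ℝ))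
      + (a + fderiv ℝ S₁ z ((0 : ℝ), (1 : ℝ), (0 : ℝ))) ^ 2 / 2
      + (fderiv ℝ S₁ z ((0 : ℝ), (0 : ℝ), (1 : ℝ))) ^ 2 / 2 + u z = c)
    (hHJ₂ : ∀ z ∈ Ω, fderiv ℝ S₂ z ((1 : ℝ), (0 : ℝ), (0 : ℝ))
      + (a + fderiv ℝ S₂ z ((0 : ℝ), (1 : ℝ), (0 : ℝ))) ^ 2 / 2
      + (fderiv ℝ S₂ z ((0 : ℝ), (0 : ℝ), (1 : ℝ))) ^ 2 / 2 + u z = c)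
    (z₀ : ℝ × ℝ × ℝ) (hz₀ : z₀ ∈ Ω)
    (hcrit : fderiv ℝ (fun z => S₁ z - S₂ z) z₀ = 0) :
    ((1 : ℝ), a + fderiv ℝ S₁ z₀ ((0 : ℝ), (1 : ℝ), (0 : ℝ)),
      fderiv ℝ S₁ z₀ ((0 : ℝ), (0 : ℝ), (1 : ℝ))) ≠ (0 : ℝ × ℝ × ℝ) ∧
    fderiv ℝ (fun z => fderiv ℝ (fun w => S₁ w - S₂ w) z) z₀
      ((1 : ℝ), a + fderiv ℝ S₁ z₀ ((0 : ℝ), (1 : ℝ), (0 : ℝ)),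
        fderiv ℝ S₁ z₀ ((0 : ℝ), (0 : ℝ), (1 : ℝ))) = 0 := by
  refine ⟨fun h => one_ne_zero (congrArg Prod.fst h), ?_⟩
  have hΩz : ∀ᶠ z in 𝓝 z₀, z ∈ Ω := hΩ.mem_nhds hz₀
  have hC₁ : ContDiffAt ℝ 2 S₁ z₀ := hS₁.contDiffAt hΩz
  have hC₂ : ContDiffAt ℝ 2 S₂ z₀ := hS₂.contDiffAt hΩz
  have hd {S : ℝ × ℝ × ℝ → ℝ} (hS : ContDiffOn ℝ 2 S Ω) {z : ℝ × ℝ × ℝ} (hz : z ∈ Ω) :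
      DifferentiableAt ℝ S z :=
    (hS.contDiffAt (hΩ.mem_nhds hz)).differentiableAt (by norm_num)
  have hgrad {S : ℝ × ℝ × ℝ → ℝ} (hS : ContDiffAt ℝ 2 S z₀) :
      HasFDerivAt (fderiv ℝ S) (fderiv ℝ (fderiv ℝ S) z₀) z₀ :=
    ((hS.fderiv_right (m := 1) (by norm_num)).differentiableAt (by norm_num)).hasFDerivAt
  have heq : fderiv ℝ S₁ z₀ = fderiv ℝ S₂ z₀ := by
    rw [fderiv_fun_sub (hd hS₁ hz₀) (hd hS₂ hz₀)] at hcrit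
    exact sub_eq_zero.mp hcrit
  set v : ℝ × ℝ × ℝ := ((1 : ℝ), a + fderiv ℝ S₁ z₀ ((0 : ℝ), (1 : ℝ), (0 : ℝ)),
    fderiv ℝ S₁ z₀ ((0 : ℝ), (0 : ℝ), (1 : ℝ))) with hv
  have hHess : fderiv ℝ (fun z => fderiv ℝ (fun w => S₁ w - S₂ w) z) z₀ =
      fderiv ℝ (fderiv ℝ S₁) z₀ - fderiv ℝ (fderiv ℝ S₂) z₀ := by
    have hloc : (fun z => fderiv ℝ (fun w => S₁ w - S₂ w) z) =ᶠ[𝓝 z₀]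
        fun z => fderiv ℝ S₁ z - fderiv ℝ S₂ z :=
      hΩz.mono fun z hz => fderiv_fun_sub (hd hS₁ hz) (hd hS₂ hz)
    rw [hloc.fderiv_eq]
    exact ((hgrad hC₁).sub (hgrad hC₂)).fderiv
  have hflip : (fderiv ℝ (fderiv ℝ S₁) z₀).flip v = (fderiv ℝ (fderiv ℝ S₂) z₀).flip v := by
    have h₁ := hasFDerivAt_hamiltonJacobi (hgrad hC₁) a (1, 0, 0) (0, 1, 0) (0, 0, 1)
    have h₂ := hasFDerivAt_hamiltonJacobi (hgrad hC₂) a (1, 0, 0) (0, 1, 0) (0, 0, 1)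
    have hvec : ((1, 0, 0) : ℝ × ℝ × ℝ) + (a + fderiv ℝ S₁ z₀ (0, 1, 0)) • (0, 1, 0) +
        fderiv ℝ S₁ z₀ (0, 0, 1) • (0, 0, 1) = v := by
      simp [hv]
    rw [← heq, hvec] at h₂
    rw [hvec] at h₁
    refine h₁.unique (h₂.congr_of_eventuallyEq (hΩz.mono fun z hz => ?_))
    linarith [hHJ₁ z hz, hHJ₂ z hz]
  rw [hHess]
  refine ContinuousLinearMap.ext fun w => ?_
  have hs₁ := hC₁.isSymmSndFDerivAt (by simp) v w
  have hs₂ := hC₂.isSymmSndFDerivAt (by simp) v w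
  have hw := DFunLike.congr_fun hflip w
  simp only [ContinuousLinearMap.flip_apply] at hw
  rw [sub_apply, sub_apply, hs₁, hs₂, hw, sub_self]
  rfl
end
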